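/- Let n ≥ 1 and let d_0, d_1, …, d_n ∈ ℕ satisfy 1 ≤ d_0 ≤ d_1 ≤ … ≤ d_n; set d := Σ_{j=0}^n d_j. Let B := {α ∈ ℕ^n : α_i ≤ d_i for all 1 ≤ i ≤ n}, let Y := { α + α' + e_i : α, α' ∈ B, 1 ≤ i ≤ n, |α + α'| ≥ d }, and let Y_P := { γ ∈ Y : there is exactly one index i ∈ {1,…,n} with γ_i > d_i }. Then |Y_P| = Σ_{j=1}^n #{ m ∈ ℕ^n : |m| ≤ d_j − d_0 and m_i ≤ d_i for all i }. (Equivalently, |Y_P| = Σ_{j=1}^n h_I(d_j − d_0), where h_I is the Hilbert function of ℂ[a_0, a_1, …, a_n]/(a_1^{d_1+1}, …, a_n^{d_n+1}); this is the count showing that the number of free parameters for extension in the moment matrix extension algorithm applied to the monomial x_0^{d_0}⋯x_n^{d_n} equals the dimension of its space of Waring decompositions.) -/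

import Mathlib

open scoped BigOperators

/-- The monomial set `B = {α : α_i ≤ d_i for 1 ≤ i ≤ n}` for the monomial
`x_0^{d_0}⋯x_n^{d_n}`. -/
def Bset (n : ℕ) (d : Fin (n+1) → ℕ) : Set (Fin n → ℕ) :=
  {α | ∀ i : Fin n, α i ≤ d i.succ}

/-- The set `Y` of (indices of) moment variables:
`Y = {α + α' + e_i : α, α' ∈ B, 1 ≤ i ≤ n, |α + α'| ≥ d}`. -/
def Yset (n : ℕ) (d : Fin (n+1) → ℕ) : Set (Fin n → ℕ) :=
  {γ | ∃ α ∈ Bset n d, ∃ α' ∈ Bset n d, ∃ i : Fin n,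
    (∑ j, d j) ≤ (∑ j, (α j + α' j)) ∧ γ = α + α' + Pi.single i 1}

/-- The set `Y_P` of parameters for extension: elements of `Y` exceeding the degree
bound in exactly one coordinate. -/
def YP (n : ℕ) (d : Fin (n+1) → ℕ) : Set (Fin n → ℕ) :=
  {γ ∈ Yset n d | ∃! i : Fin n, d i.succ < γ i}

/-- The reflection sending the complement exponents to a parameter exceeding in coordinate j. -/
def reflJ (n : ℕ) (d : Fin (n+1) → ℕ) (j : Fin n) (m : Fin n → ℕ) : Fin n → ℕ :=
  fun i => d i.succ + (if i = j then d j.succ + 1 else 0) - m i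

lemma reflJ_sum (n : ℕ) (d : Fin (n+1) → ℕ) (j : Fin n) (m : Fin n → ℕ)
    (h : ∀ i, m i ≤ d i.succ + (if i = j then d j.succ + 1 else 0)) :
    ∑ i, reflJ n d j m i + ∑ i, m i = ∑ i : Fin n, d i.succ + (d j.succ + 1) := by
  have h1 : ∑ i : Fin n, (if i = j then d j.succ + 1 else 0) = d j.succ + 1 := by simp
  rw [← Finset.sum_add_distrib]
  conv_rhs => rw [← h1]
  rw [← Finset.sum_add_distrib]
  refine Finset.sum_congr rfl fun i _ => ?_
  have := h i
  unfold reflJ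
  omega

lemma YP_eq (n : ℕ) (d : Fin (n+1) → ℕ) (hmono : Monotone d) :
    YP n d = ⋃ j : Fin n, Set.image (reflJ n d j)
      {m : Fin n → ℕ | (∑ i, m i) ≤ d j.succ - d 0 ∧ ∀ i, m i ≤ d i.succ} := by
  ext γ
  simp only [Set.mem_iUnion, Set.mem_image, Set.mem_setOf_eq, YP]
  constructor
  · rintro ⟨⟨α, hα, β, hβ, k, hs, hγ⟩, j, hj, huniq⟩
    have hle : ∀ i, γ i ≤ d i.succ + (if i = j then d j.succ + 1 else 0) := by
      intro i
      by_cases hij : i = j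
      · subst hij
        have h1 := hα i
        have h2 := hβ i
        have h3 : (Pi.single k 1 : Fin n → ℕ) i ≤ 1 := by
          rw [Pi.single_apply]; split_ifs <;> omega
        simp only [hγ, Pi.add_apply, if_true]
        omega
      · have : ¬ d i.succ < γ i := fun h => hij (huniq i h)
        omega
    have hinv : reflJ n d j (reflJ n d j γ) = γ := by
      funext i
      have := hle i
      unfold reflJ
      omega
    have hS := reflJ_sum n d j γ hle
    have hγs : ∑ i, γ i = ∑ i, (α i + β i) + 1 := by
      rw [hγ]
      simp [Finset.sum_add_distrib]
    rw [Fin.sum_univ_succ] at hs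
    refine ⟨j, reflJ n d j γ, ⟨by omega, fun i => ?_⟩, hinv⟩
    unfold reflJ
    have hj' : d j.succ < γ j := hj
    by_cases hij : i = j
    · subst hij; simp only [if_true]; omega
    · simp only [hij, if_false]; omega
  · rintro ⟨j, m, ⟨hs, hm⟩, rfl⟩
    have hd := hmono (Fin.zero_le j.succ)
    have hS := reflJ_sum n d j m (fun i => (hm i).trans (Nat.le_add_right _ _))
    have hjj : reflJ n d j m j = d j.succ + (d j.succ + 1) - m j := by simp [reflJ]
    have hij : ∀ i, i ≠ j → reflJ n d j m i = d i.succ - m i := by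
      intro i h; simp [reflJ, h]
    have hmj := hm j
    refine ⟨⟨fun i => if i = j then d j.succ else reflJ n d j m i, ?_,
      fun i => if i = j then d j.succ - m j else 0, ?_, j, ?_⟩, j, ?_, ?_⟩
    · intro i
      by_cases h : i = j
      · simp [h]
      · simp only [h, if_false]; rw [hij i h]; omega
    · intro i
      by_cases h : i = j
      · simp [h]
      · simp [h]
    · rw [and_comm]
      refine ⟨?_, ?_⟩
      · funext i
        by_cases h : i = j
        · subst h
          simp only [Pi.add_apply, if_true, Pi.single_eq_same]; omega
        · simp [h]
      · have e : ∑ i, reflJ n d j m i = ∑ i, ((if i = j then d j.succ else reflJ n d j m i)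
            + (if i = j then d j.succ - m j else 0)) + 1 := by
          have h1 : ∑ i : Fin n, (if i = j then 1 else 0) = 1 := by simp
          conv_rhs => rw [← h1]
          rw [← Finset.sum_add_distrib]
          refine Finset.sum_congr rfl fun i _ => ?_
          by_cases h : i = j
          · subst h
            simp only [if_true]; omega
          · simp [h]
        rw [Fin.sum_univ_succ]
        beta_reduce
        omega
    · change _ < _
      omega
    · intro i hi
      by_contra h
      have := hij i h
      change d i.succ < _ at hi
      omega

/-- The number of free parameters for extension for the monomial
`x_0^{d_0}⋯x_n^{d_n}` equals `Σ_{j=1}^n h_I(d_j − d_0)`, the dimension of the space of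
Waring decompositions of the monomial. -/
theorem statement19 (n : ℕ) (hn : 1 ≤ n) (d : Fin (n+1) → ℕ)
    (hd0 : 1 ≤ d 0) (hmono : Monotone d) :
    (YP n d).ncard
      = ∑ j : Fin n,
          {m : Fin n → ℕ | (∑ i, m i) ≤ d j.succ - d 0 ∧ ∀ i, m i ≤ d i.succ}.ncard := by
  rw [YP_eq n d hmono, Set.ncard_iUnion_of_finite]
  · rw [finsum_eq_sum_of_fintype]
    refine Finset.sum_congr rfl fun j _ => ?_
    refine Set.ncard_image_of_injOn ?_
    rintro m ⟨-, hm⟩ m' ⟨-, hm'⟩ h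
    funext i
    have h1 := congrFun h i
    have h2 := hm i
    have h3 := hm' i
    unfold reflJ at h1
    omega
  · intro j
    refine Set.Finite.image _ ((Set.finite_Iic (fun i : Fin n => d i.succ)).subset ?_)
    rintro m ⟨-, hm⟩
    exact hm
  · intro j k hjk
    rw [Function.onFun, Set.disjoint_left]
    rintro _ ⟨m, ⟨-, hm⟩, rfl⟩ ⟨m', ⟨-, hm'⟩, h⟩
    have h1 := congrFun h j
    have h2 := hm j
    simp [reflJ, hjk] at h1
    omega
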